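/- arXiv:1607.05136 — 5 statements merged into one kernel-verified Lean document; each statement's English description precedes it below -/
import Mathlib

section
/- Let (a_n) and (z_n) be real sequences with a_n ≠ 0, a_n = O(n^{-1/2}) and z_n = a_n(1 + O(n^{-1})) as n → ∞. For each n set c_n = c(a_n, z_n), s_n = 1 − a_n c_n and z_n^c = z_n + c_n/s_n, and for each parameter φ with 1 + a_nφ > 0 define: the distribution function G_n(y;φ) = Φ((y − φ)/(s_n(1 + a_nφ)) + z_n^c); the median function b_n(φ) = φ − z_n^c s_n (1 + a_nφ) (assumed strictly increasing, i.e. a_n z_n^c s_n < 1); the log-likelihood ratio w_n(φ;t) = −(z_n^c)² + ((t − φ)/(s_n(1 + a_nφ)) + z_n^c)² − 2 log((1 + a_n t)/(1 + a_nφ)); its median-bias-corrected version w_n^*(φ;t) = w_n(b_n(φ);t); the sampling distribution F_n^*(y;φ) = P(w_n^*(φ; φ + s_n(1+a_nφ)(Z − z_n^c)) ≤ y) where Z is standard normal; the confidence distributions C_n(φ;t) = 1 − G_n(t;φ) and H_n^*(φ;t) = ½{1 − sign(b_n^{-1}(t) − φ) · F_n^*(w_n^*(φ;t);φ)}. Then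 for every pair of sequences (φ_n, t_n) with 1 + a_nφ_n > 0, 1 + a_n t_n > 0 and (φ_n − t_n)/(1 + a_nφ_n) bounded in n, one has H_n^*(φ_n;t_n) − C_n(φ_n;t_n) = O(n^{-3/2}) as n → ∞. -/
open MeasureTheory ProbabilityTheory

/-- The standard normal cumulative distribution function `Φ`. -/
noncomputable def stdNormCDF (x : ℝ) : ℝ :=
  ((gaussianReal 0 1) (Set.Iic x)).toReal

/-- The stationarity constant `c(a,z)` of Efron's normal transformation family. -/
noncomputable def efronC (a z : ℝ) : ℝ :=
  1 / a - ((1 - a * z) / (2 * a ^ 3)) *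
    (Real.sqrt (1 + 4 * a ^ 2 / (1 - a * z) ^ 2) - 1)

/-- `s = 1 − a·c(a,z)`. -/
noncomputable def efronS (a z : ℝ) : ℝ := 1 - a * efronC a z

/-- `z^c = z + c/s`. -/
noncomputable def efronZc (a z : ℝ) : ℝ := z + efronC a z / efronS a z

/-- Distribution function `G(y;φ) = Φ((y − φ)/(s(1 + aφ)) + z^c)` of the corrected MLE. -/
noncomputable def efronG (a s zc φ y : ℝ) : ℝ :=
  stdNormCDF ((y - φ) / (s * (1 + a * φ)) + zc)

/-- Median function `b(φ) = φ − z^c·s·(1 + aφ)`. -/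
def efronB (a s zc φ : ℝ) : ℝ := φ - zc * s * (1 + a * φ)

/-- Inverse of the (affine, strictly increasing) median function `b`. -/
noncomputable def efronBinv (a s zc t : ℝ) : ℝ := (t + zc * s) / (1 - a * zc * s)

/-- Log-likelihood ratio `w(φ;t)`. -/
noncomputable def efronW (a s zc φ t : ℝ) : ℝ :=
  -zc ^ 2 + ((t - φ) / (s * (1 + a * φ)) + zc) ^ 2
    - 2 * Real.log ((1 + a * t) / (1 + a * φ))

/-- Median-bias-corrected log-likelihood ratio `w^*(φ;t) = w(b(φ);t)`. -/
noncomputable def efronWstar (a s zc φ t : ℝ) : ℝ :=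
  efronW a s zc (efronB a s zc φ) t

/-- Sampling distribution `F^*(y;φ) = P(w^*(φ; φ + s(1+aφ)(Z − z^c)) ≤ y)`,
`Z` standard normal. -/
noncomputable def efronFstar (a s zc φ y : ℝ) : ℝ :=
  ((gaussianReal 0 1)
      {ζ : ℝ | efronWstar a s zc φ (φ + s * (1 + a * φ) * (ζ - zc)) ≤ y}).toReal

/-- Confidence distribution `C(φ;t) = 1 − G(t;φ)`. -/
noncomputable def efronCconf (a s zc φ t : ℝ) : ℝ := 1 - efronG a s zc φ t

/-- `H^*(φ;t) = ½{1 − sign(b⁻¹(t) − φ)·F^*(w^*(φ;t);φ)}`. -/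
noncomputable def efronHstar (a s zc φ t : ℝ) : ℝ :=
  (1 / 2) * (1 - Real.sign (efronBinv a s zc t - φ)
    * efronFstar a s zc φ (efronWstar a s zc φ t))

noncomputable def auxG (α x : ℝ) : ℝ := x ^ 2 + 2 * α * x - 2 * Real.log (1 + α * x)

lemma aux_alg (a z : ℝ) (ha : a ≠ 0) (hu : 0 < 1 - a * z) :
    0 < efronS a z ∧ a ^ 2 * efronS a z ^ 2 + (1 - a * z) * efronS a z = 1 ∧
      efronZc a z = a * efronS a z := by
  set u := 1 - a * z with hu_def
  set q := Real.sqrt (1 + 4 * a ^ 2 / u ^ 2) with hq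
  have hpos : 0 < 4 * a ^ 2 / u ^ 2 := by positivity
  have hq2 : q ^ 2 = 1 + 4 * a ^ 2 / u ^ 2 := Real.sq_sqrt (by linarith)
  have hq1 : 1 < q := by
    rw [hq]; apply Real.lt_sqrt_of_sq_lt; linarith
  have hS : efronS a z = u / (2 * a ^ 2) * (q - 1) := by
    unfold efronS efronC
    rw [← hu_def, ← hq]
    field_simp
    ring
  have hSpos : 0 < efronS a z := by
    rw [hS]
    have : 0 < q - 1 := by linarith
    positivity
  have hquad : a ^ 2 * efronS a z ^ 2 + u * efronS a z = 1 := by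
    have h1 : a ^ 2 * efronS a z ^ 2 + u * efronS a z = u ^ 2 / (4 * a ^ 2) * (q ^ 2 - 1) := by
      rw [hS]; field_simp; ring
    rw [h1, hq2]; field_simp; ring
  refine ⟨hSpos, hquad, ?_⟩
  have hC : efronC a z = (1 - efronS a z) / a := by
    unfold efronS; field_simp; ring
  unfold efronZc
  rw [hC]
  field_simp
  rw [hu_def] at hquad
  linear_combination (-1) * hquad

lemma aux_wstar (a s φ ζ : ℝ) (hs : 0 < s) (hA : 0 < 1 + a * φ) (hk : (a * s) ^ 2 < 1) :
    efronWstar a s (a * s) φ (φ + s * (1 + a * φ) * (ζ - a * s)) =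
      auxG (a * s) (ζ / (1 - (a * s) ^ 2)) := by
  have hk' : (1 - (a * s) ^ 2) ≠ 0 := by linarith
  have hs' := hs.ne'
  have hA' := hA.ne'
  have hB : 1 + a * efronB a s (a * s) φ = (1 + a * φ) * (1 - (a * s) ^ 2) := by
    unfold efronB; ring
  have hT : φ + s * (1 + a * φ) * (ζ - a * s) - efronB a s (a * s) φ = s * (1 + a * φ) * ζ := by
    unfold efronB; ring
  have hL : 1 + a * (φ + s * (1 + a * φ) * (ζ - a * s)) =
      (1 + a * φ) * (1 - (a * s) ^ 2 + a * s * ζ) := by ring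
  unfold efronWstar efronW auxG
  rw [hB, hT, hL]
  have e1 : s * (1 + a * φ) * ζ / (s * ((1 + a * φ) * (1 - (a * s) ^ 2))) =
      ζ / (1 - (a * s) ^ 2) := by
    rw [← mul_assoc, mul_div_mul_left _ _ (mul_ne_zero hs' hA')]
  have e2 : (1 + a * φ) * (1 - (a * s) ^ 2 + a * s * ζ) / ((1 + a * φ) * (1 - (a * s) ^ 2)) =
      1 + a * s * (ζ / (1 - (a * s) ^ 2)) := by
    rw [mul_div_mul_left _ _ hA', add_div, div_self hk', mul_div_assoc]
  rw [e1, e2]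
  ring

lemma aux_taylor (α x : ℝ) (h : |α * x| ≤ 1 / 2) :
    |auxG α x - (1 + α ^ 2) * x ^ 2| ≤ 4 * |α| ^ 3 * |x| ^ 3 := by
  have h1 := Real.abs_log_sub_add_sum_range_le (x := -(α * x)) (by rw [abs_neg]; linarith) 2
  simp only [Finset.sum_range_succ, Finset.sum_range_zero, abs_neg] at h1
  norm_num at h1
  have h2 : |α * x| ^ 3 / (1 - |α * x|) ≤ 2 * |α * x| ^ 3 := by
    rw [div_le_iff₀ (by linarith)]
    have : 0 ≤ |α * x| ^ 3 := by positivity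
    nlinarith
  have h3 : |α * x| ^ 3 = |α| ^ 3 * |x| ^ 3 := by rw [abs_mul, mul_pow]
  rw [← abs_mul] at h1
  have h4 := abs_le.1 (h1.trans h2)
  rw [h3] at h4
  unfold auxG
  rw [abs_le]
  constructor <;> nlinarith [h4.1, h4.2]

lemma aux_diff (α x y R : ℝ) (hR : |y| ≤ R) (hα : |α| * R ≤ 1 / 2) (hx : |x| ≤ |y|) :
    (|y| - |x| - 8 * R ^ 2 * |α| ^ 3) * |y| ≤ auxG α y - auxG α x := by
  have hx0 := abs_nonneg x
  have hy0 := abs_nonneg y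
  have hα0 := abs_nonneg α
  have h1 := abs_le.1 (aux_taylor α x (by rw [abs_mul]; nlinarith))
  have h2 := abs_le.1 (aux_taylor α y (by rw [abs_mul]; nlinarith))
  have h3 : |x| ^ 3 ≤ R ^ 2 * |y| := by
    calc |x| ^ 3 = |x| ^ 2 * |x| := by ring
      _ ≤ R ^ 2 * |y| := by gcongr; linarith
  have h4 : |y| ^ 3 ≤ R ^ 2 * |y| := by
    calc |y| ^ 3 = |y| ^ 2 * |y| := by ring
      _ ≤ R ^ 2 * |y| := by gcongr
  have h5 : 0 ≤ |α| ^ 3 := by positivity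
  have h6 : 4 * |α| ^ 3 * |x| ^ 3 + 4 * |α| ^ 3 * |y| ^ 3 ≤ 8 * R ^ 2 * |α| ^ 3 * |y| := by
    nlinarith [mul_le_mul_of_nonneg_left h3 h5, mul_le_mul_of_nonneg_left h4 h5]
  have h8 : (|y| - |x|) * |y| ≤ y ^ 2 - x ^ 2 := by
    rw [← sq_abs y, ← sq_abs x]; nlinarith
  have h9 : 0 ≤ α ^ 2 * (y ^ 2 - x ^ 2) := by
    apply mul_nonneg (sq_nonneg _)
    nlinarith
  nlinarith

lemma aux_mono (α x y R : ℝ) (hR : |y| ≤ R) (hα : |α| * R ≤ 1 / 2)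
    (hxy : |x| + 8 * R ^ 2 * |α| ^ 3 < |y|) : auxG α x < auxG α y := by
  have hx0 := abs_nonneg x
  have hd : 0 ≤ 8 * R ^ 2 * |α| ^ 3 := by positivity
  have h := aux_diff α x y R hR hα (by linarith)
  have : 0 < (|y| - |x| - 8 * R ^ 2 * |α| ^ 3) * |y| := mul_pos (by linarith) (by linarith)
  linarith

lemma aux_mono_le (α x y R : ℝ) (hR : |y| ≤ R) (hα : |α| * R ≤ 1 / 2)
    (hxy : |x| + 8 * R ^ 2 * |α| ^ 3 ≤ |y|) : auxG α x ≤ auxG α y := by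
  have hx0 := abs_nonneg x
  have hd : 0 ≤ 8 * R ^ 2 * |α| ^ 3 := by positivity
  have h := aux_diff α x y R hR hα (by linarith)
  have : 0 ≤ (|y| - |x| - 8 * R ^ 2 * |α| ^ 3) * |y| := mul_nonneg (by linarith) (by linarith)
  linarith

lemma aux_far (α x y M : ℝ) (hx : |x| ≤ M) (hα : |α| * (2 * M + 4) ≤ 1 / 2)
    (hy : 2 * M + 4 ≤ |y|) : auxG α x < auxG α y := by
  have hx0 := abs_nonneg x
  have hα0 := abs_nonneg α
  have hM : 0 ≤ M := by linarith
  have hα4 : |α| ≤ 1 / 8 := by nlinarith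
  have hαx : |α| * |x| ≤ 1 / 2 := by nlinarith
  have h1 := (abs_le.1 (aux_taylor α x (by rw [abs_mul]; exact hαx))).2
  have h2 : 4 * |α| ^ 3 * |x| ^ 3 ≤ 1 / 2 := by
    have : (|α| * |x|) ^ 3 ≤ (1 / 2) ^ 3 := by gcongr
    rw [mul_pow] at this; linarith
  have h3 : (1 + α ^ 2) * x ^ 2 ≤ 2 * M ^ 2 := by
    rw [← sq_abs α, ← sq_abs x]
    have : |α| ^ 2 ≤ 1 := by nlinarith
    have : |x| ^ 2 ≤ M ^ 2 := by gcongr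
    gcongr; linarith
  have h4 : Real.log (1 + α * y) ≤ |1 + α * y| := by
    rw [← Real.log_abs]
    exact Real.log_le_self (abs_nonneg _)
  have h5 : |1 + α * y| ≤ 1 + |α| * |y| := by
    rw [← abs_mul]; simpa using abs_add_le 1 (α * y)
  have h6 : -(|α| * |y|) ≤ α * y := by rw [← abs_mul]; exact neg_abs_le _
  have h7 : |α| * |y| ≤ 1 / 8 * |y| := by gcongr
  have h8 : |y| ^ 2 - |y| - 2 ≤ auxG α y := by
    unfold auxG; rw [sq_abs]; nlinarith
  nlinarith

lemma aux_lip (x y : ℝ) (h : x ≤ y) : stdNormCDF y - stdNormCDF x ≤ y - x := by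
  have h1 : gaussianReal 0 1 (Set.Ioc x y) ≤ ENNReal.ofReal (y - x) := by
    rw [gaussianReal_apply 0 one_ne_zero]
    calc ∫⁻ w in Set.Ioc x y, gaussianPDF 0 1 w
        ≤ ∫⁻ w in Set.Ioc x y, 1 := by
          apply lintegral_mono
          intro w
          unfold gaussianPDF
          rw [← ENNReal.ofReal_one]
          apply ENNReal.ofReal_le_ofReal
          unfold gaussianPDFReal
          have hs : 1 ≤ √(2 * Real.pi * ((1 : NNReal) : ℝ)) := by
            rw [Real.one_le_sqrt]
            have := Real.pi_gt_three
            norm_num; linarith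
          have he : Real.exp (-(w - 0) ^ 2 / (2 * ((1 : NNReal) : ℝ))) ≤ 1 := by
            rw [Real.exp_le_one_iff]
            norm_num
            have := sq_nonneg w
            linarith
          have hi := inv_le_one_of_one_le₀ hs
          have h0 := (Real.exp_pos (-(w - 0) ^ 2 / (2 * ((1 : NNReal) : ℝ)))).le
          exact mul_le_one₀ hi h0 he
      _ = ENNReal.ofReal (y - x) := by simp
  have h2 : stdNormCDF y ≤ stdNormCDF x + (gaussianReal 0 1).real (Set.Ioc x y) := by
    have := measureReal_union_le (μ := gaussianReal 0 1) (Set.Iic x) (Set.Ioc x y)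
    rw [Set.Iic_union_Ioc_eq_Iic h] at this
    exact this
  have h3 : (gaussianReal 0 1).real (Set.Ioc x y) ≤ y - x :=
    ENNReal.toReal_le_of_le_ofReal (by linarith) h1
  linarith

lemma aux_mono_cdf {x y : ℝ} (h : x ≤ y) : stdNormCDF x ≤ stdNormCDF y :=
  measureReal_mono (μ := gaussianReal 0 1) (Set.Iic_subset_Iic.2 h)

lemma aux_neg (x : ℝ) : stdNormCDF (-x) = 1 - stdNormCDF x := by
  have h1 : gaussianReal 0 1 (Set.Iic (-x)) = gaussianReal 0 1 (Set.Ici x) := by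
    have h := gaussianReal_map_neg (μ := 0) (v := 1)
    rw [neg_zero] at h
    conv_lhs => rw [← h]
    rw [Measure.map_apply measurable_neg measurableSet_Iic]
    congr 1
    ext w; simp
  have := nullSingletonClass_gaussianReal (μ := 0) (v := 1) one_ne_zero
  have h2 : gaussianReal 0 1 (Set.Ici x) = gaussianReal 0 1 (Set.Ioi x) :=
    measure_congr Ioi_ae_eq_Ici.symm
  unfold stdNormCDF
  rw [h1, h2, ← Set.compl_Iic]
  exact probReal_compl_eq_one_sub measurableSet_Iic

lemma aux_le_sym (r : ℝ) :
    2 * stdNormCDF r - 1 ≤ (gaussianReal 0 1).real (Set.Icc (-r) r) := by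
  have h1 : stdNormCDF r ≤ stdNormCDF (-r) + (gaussianReal 0 1).real (Set.Icc (-r) r) := by
    refine le_trans ?_ (measureReal_union_le (μ := gaussianReal 0 1) (Set.Iic (-r)) (Set.Icc (-r) r))
    refine measureReal_mono (fun w hw => ?_)
    simp only [Set.mem_Iic, Set.mem_union, Set.mem_Icc] at *
    rcases le_total w (-r) with h | h
    · exact Or.inl h
    · exact Or.inr ⟨h, hw⟩
  rw [aux_neg] at h1
  linarith

lemma aux_ge_sym (r : ℝ) (hr : 0 ≤ r) :
    (gaussianReal 0 1).real (Set.Icc (-r) r) ≤ 2 * stdNormCDF r - 1 := by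
  have := nullSingletonClass_gaussianReal (μ := 0) (v := 1) one_ne_zero
  have h1 : (gaussianReal 0 1).real (Set.Icc (-r) r) = (gaussianReal 0 1).real (Set.Ioc (-r) r) :=
    measureReal_congr Ioc_ae_eq_Icc.symm
  have h2 : (gaussianReal 0 1).real (Set.Iic (-r) ∪ Set.Ioc (-r) r) =
      (gaussianReal 0 1).real (Set.Iic (-r)) + (gaussianReal 0 1).real (Set.Ioc (-r) r) :=
    measureReal_union (by
      rw [Set.disjoint_left]; intro w hw hw'
      simp only [Set.mem_Iic, Set.mem_Ioc] at *
      linarith) measurableSet_Ioc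
  rw [Set.Iic_union_Ioc_eq_Iic (by linarith)] at h2
  have h3 : stdNormCDF r = stdNormCDF (-r) + (gaussianReal 0 1).real (Set.Ioc (-r) r) := h2
  rw [aux_neg] at h3
  rw [h1]; linarith

/-- The sampling distribution is within `2 δ` of the symmetric interval probability. -/
lemma aux_F (α ζ₀ M : ℝ) (hM : |ζ₀ / (1 - α ^ 2)| ≤ M) (hα : |α| * (2 * M + 4) ≤ 1 / 2) :
    |((gaussianReal 0 1) {ζ : ℝ | auxG α (ζ / (1 - α ^ 2)) ≤ auxG α (ζ₀ / (1 - α ^ 2))}).toReal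
      - (2 * stdNormCDF |ζ₀| - 1)| ≤ 2 * (8 * (2 * M + 4) ^ 2 * |α| ^ 3) := by
  set S := {ζ : ℝ | auxG α (ζ / (1 - α ^ 2)) ≤ auxG α (ζ₀ / (1 - α ^ 2))} with hS
  set δ := 8 * (2 * M + 4) ^ 2 * |α| ^ 3 with hδ
  have hα0 := abs_nonneg α
  have hM0 : 0 ≤ M := (abs_nonneg _).trans hM
  have hδ0 : 0 ≤ δ := by positivity
  have hα4 : |α| ≤ 1 / 8 := by nlinarith
  have hk : 0 < 1 - α ^ 2 := by rw [← sq_abs]; nlinarith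
  have hk1 : 1 - α ^ 2 ≤ 1 := by nlinarith [sq_nonneg α]
  have hdiv : ∀ w : ℝ, |w| = (1 - α ^ 2) * |w / (1 - α ^ 2)| := by
    intro w; rw [abs_div, abs_of_pos hk]; field_simp
  have hup : S ⊆ Set.Icc (-(|ζ₀| + δ)) (|ζ₀| + δ) := by
    intro w hw
    rw [hS, Set.mem_ofPred_eq] at hw
    rw [Set.mem_Icc, ← abs_le]
    by_contra hcon
    push Not at hcon
    rcases le_total (2 * M + 4) |w / (1 - α ^ 2)| with h | h
    · exact absurd (aux_far α _ _ M hM hα h) (not_lt.2 hw)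
    · refine absurd (aux_mono α (ζ₀ / (1 - α ^ 2)) _ _ h hα ?_) (not_lt.2 hw)
      rw [hdiv w, hdiv ζ₀] at hcon
      rw [← hδ]
      nlinarith
  have hlow : Set.Icc (-(|ζ₀| - δ)) (|ζ₀| - δ) ⊆ S := by
    intro w hw
    rw [Set.mem_Icc, ← abs_le] at hw
    rw [hS, Set.mem_ofPred_eq]
    refine aux_mono_le α _ (ζ₀ / (1 - α ^ 2)) (2 * M + 4) (by linarith) hα ?_
    rw [hdiv w, hdiv ζ₀] at hw
    rw [← hδ]
    nlinarith
  have m1 := measureReal_mono (μ := gaussianReal 0 1) hup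
  have m2 := measureReal_mono (μ := gaussianReal 0 1) hlow
  have m3 := aux_ge_sym (|ζ₀| + δ) (by positivity)
  have m4 := aux_le_sym (|ζ₀| - δ)
  have m5 := aux_lip |ζ₀| (|ζ₀| + δ) (by linarith)
  have m6 := aux_lip (|ζ₀| - δ) |ζ₀| (by linarith)
  change |(gaussianReal 0 1).real S - _| ≤ _
  rw [abs_le]; constructor <;> linarith

lemma aux_main (a s φ t M : ℝ) (hs : 0 < s) (hA : 0 < 1 + a * φ)
    (hM : |((t - φ) / (s * (1 + a * φ)) + a * s) / (1 - (a * s) ^ 2)| ≤ M)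
    (hα : |a * s| * (2 * M + 4) ≤ 1 / 2) :
    |efronHstar a s (a * s) φ t - efronCconf a s (a * s) φ t| ≤
      8 * (2 * M + 4) ^ 2 * |a * s| ^ 3 := by
  set ζ₀ := (t - φ) / (s * (1 + a * φ)) + a * s with hζ
  have hα0 := abs_nonneg (a * s)
  have hM0 : 0 ≤ M := (abs_nonneg _).trans hM
  have hα4 : |a * s| ≤ 1 / 8 := by nlinarith
  have hk : (a * s) ^ 2 < 1 := by rw [← sq_abs]; nlinarith
  have ht : t = φ + s * (1 + a * φ) * (ζ₀ - a * s) := by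
    have hne : s * (1 + a * φ) ≠ 0 := (mul_pos hs hA).ne'
    rw [hζ, add_sub_cancel_right, mul_div_cancel₀ _ hne]; ring
  have hF := aux_F (a * s) ζ₀ M hM hα
  have hFeq : efronFstar a s (a * s) φ (efronWstar a s (a * s) φ t) =
      ((gaussianReal 0 1) {ζ : ℝ | auxG (a * s) (ζ / (1 - (a * s) ^ 2)) ≤
        auxG (a * s) (ζ₀ / (1 - (a * s) ^ 2))}).toReal := by
    unfold efronFstar
    rw [ht, aux_wstar a s φ ζ₀ hs hA hk]
    simp_rw [aux_wstar a s φ _ hs hA hk]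
  rw [← hFeq] at hF
  set F := efronFstar a s (a * s) φ (efronWstar a s (a * s) φ t) with hFd
  have hB : efronBinv a s (a * s) t - φ = s * (1 + a * φ) / (1 - (a * s) ^ 2) * ζ₀ := by
    have hk' : 1 - (a * s) ^ 2 ≠ 0 := by linarith
    have e : 1 - a * (a * s) * s = 1 - (a * s) ^ 2 := by ring
    unfold efronBinv
    rw [e, div_sub' hk', div_mul_eq_mul_div]
    congr 1
    conv_lhs => rw [ht]
    ring
  have hpos : 0 < s * (1 + a * φ) / (1 - (a * s) ^ 2) := by
    have : 0 < 1 - (a * s) ^ 2 := by linarith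
    positivity
  have hdiff : efronHstar a s (a * s) φ t - efronCconf a s (a * s) φ t =
      stdNormCDF ζ₀ - 1 / 2 - 1 / 2 * (Real.sign (efronBinv a s (a * s) t - φ) * F) := by
    unfold efronHstar efronCconf efronG
    rw [← hζ, ← hFd]; ring
  rw [hdiff, hB]
  have hF' := abs_le.1 hF
  rcases lt_trichotomy ζ₀ 0 with h | h | h
  · rw [Real.sign_of_neg (mul_neg_of_pos_of_neg hpos h)]
    rw [abs_of_neg h, aux_neg] at hF'
    rw [abs_le]; constructor <;> linarith [hF'.1, hF'.2]
  · rw [h]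
    have := aux_neg 0
    rw [neg_zero] at this
    have h2 : stdNormCDF 0 = 1 / 2 := by linarith
    rw [h2]; simp; positivity
  · rw [Real.sign_of_pos (mul_pos hpos h)]
    rw [abs_of_pos h] at hF'
    rw [abs_le]; constructor <;> linarith [hF'.1, hF'.2]

/-- Theorem 1 of the paper, φ-scale: with `aₙ ≠ 0`, `aₙ = O(n^{-1/2})`,
`zₙ = aₙ(1 + O(n⁻¹))`, and `bₙ` strictly increasing (`aₙ zₙ^c sₙ < 1`), for any
sequences `(φₙ, tₙ)` with `1 + aₙφₙ > 0`, `1 + aₙtₙ > 0` and `(φₙ − tₙ)/(1 + aₙφₙ)`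
bounded, one has `Hₙ^*(φₙ;tₙ) − Cₙ(φₙ;tₙ) = O(n^{-3/2})`. -/
theorem stmt_0 (a z : ℕ → ℝ) (ha : ∀ n, a n ≠ 0)
    (haO : (fun n : ℕ => a n) =O[Filter.atTop] fun n : ℕ => (n : ℝ) ^ (-(1 : ℝ) / 2))
    (hz : ∃ e : ℕ → ℝ,
      ((fun n : ℕ => e n) =O[Filter.atTop] fun n : ℕ => ((n : ℝ))⁻¹) ∧
      ∀ n, z n = a n * (1 + e n))
    (hmono : ∀ n, a n * efronZc (a n) (z n) * efronS (a n) (z n) < 1) :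
    ∀ φ t : ℕ → ℝ,
      (∀ n, 1 + a n * φ n > 0) → (∀ n, 1 + a n * t n > 0) →
      ((fun n : ℕ => (φ n - t n) / (1 + a n * φ n)) =O[Filter.atTop]
        fun _ : ℕ => (1 : ℝ)) →
      (fun n : ℕ =>
          efronHstar (a n) (efronS (a n) (z n)) (efronZc (a n) (z n)) (φ n) (t n)
          - efronCconf (a n) (efronS (a n) (z n)) (efronZc (a n) (z n)) (φ n) (t n))
        =O[Filter.atTop] fun n : ℕ => (n : ℝ) ^ (-(3 : ℝ) / 2) := by
  intro φ t hφ ht hb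
  obtain ⟨e, he, hze⟩ := hz
  have hn2 : Filter.Tendsto (fun n : ℕ => (n : ℝ) ^ (-(1 : ℝ) / 2)) Filter.atTop (nhds 0) := by
    have := (tendsto_rpow_neg_atTop (y := 1 / 2) (by norm_num)).comp
      (tendsto_natCast_atTop_atTop (R := ℝ))
    refine this.congr fun n => ?_
    simp only [Function.comp]
    norm_num
  have ha0 : Filter.Tendsto a Filter.atTop (nhds 0) := haO.trans_tendsto hn2
  have he0 : Filter.Tendsto e Filter.atTop (nhds 0) :=
    he.trans_tendsto tendsto_inv_atTop_nhds_zero_nat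
  have hu0 : Filter.Tendsto (fun n => a n * z n) Filter.atTop (nhds 0) := by
    have h : Filter.Tendsto (fun n => a n * (a n * (1 + e n))) Filter.atTop
        (nhds (0 * (0 * (1 + 0)))) := ha0.mul (ha0.mul (he0.const_add 1))
    simp only [zero_mul] at h
    refine h.congr fun n => ?_
    rw [hze n]
  obtain ⟨K, hK⟩ := haO.bound
  obtain ⟨B, hB⟩ := hb.bound
  set M : ℝ := 8 * (|B| + 1) with hM
  have hM0 : 0 < M := by positivity
  have hsm : ∀ᶠ n in Filter.atTop, |a n| < 1 / (4 * (2 * M + 4)) := by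
    have h := (tendsto_order.1 ha0.abs).2 (1 / (4 * (2 * M + 4)))
      (by rw [abs_zero]; positivity)
    exact h
  have hsu : ∀ᶠ n in Filter.atTop, |a n * z n| < 1 / 2 := by
    have h := (tendsto_order.1 hu0.abs).2 (1 / 2) (by rw [abs_zero]; positivity)
    exact h
  refine Asymptotics.IsBigO.of_bound (8 * (2 * M + 4) ^ 2 * (2 * |K|) ^ 3) ?_
  filter_upwards [hK, hB, hsm, hsu] with n hKn hBn hsmn hsun
  obtain ⟨hs, hq, hzc⟩ := aux_alg (a n) (z n) (ha n) (by linarith [(abs_lt.1 hsun).2])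
  rw [hzc]
  set s := efronS (a n) (z n) with hsd
  have hA := hφ n
  have hsmn' : |a n| * (4 * (2 * M + 4)) ≤ 1 := by
    rw [lt_div_iff₀ (by positivity)] at hsmn; exact hsmn.le
  have ha4 : |a n| ≤ 1 / 16 := by nlinarith [abs_nonneg (a n)]
  have ha2 : a n ^ 2 ≤ 1 / 16 := by rw [← sq_abs]; nlinarith [abs_nonneg (a n)]
  have hs2 : s ≤ 2 := by nlinarith [(abs_lt.1 hsun).2, sq_nonneg (a n * s)]
  have hs4 : 1 / 2 ≤ s := by
    have h1 : a n ^ 2 * s ^ 2 ≤ 1 / 16 * (2 * s) := by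
      have : s ^ 2 ≤ 2 * s := by nlinarith
      have h0 : 0 ≤ s ^ 2 := by positivity
      nlinarith
    nlinarith [(abs_lt.1 hsun).1]
  have hαabs : |a n * s| ≤ 2 * |a n| := by
    rw [abs_mul, abs_of_pos hs]; nlinarith [abs_nonneg (a n)]
  have hα : |a n * s| * (2 * M + 4) ≤ 1 / 2 := by nlinarith
  have hα0 := abs_nonneg (a n * s)
  have hk : 1 / 2 ≤ 1 - (a n * s) ^ 2 := by
    rw [← sq_abs]; nlinarith
  have hbd : |(t n - φ n) / (s * (1 + a n * φ n))| ≤ 2 * |B| := by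
    have h1 : (t n - φ n) / (s * (1 + a n * φ n)) =
        -((φ n - t n) / (1 + a n * φ n)) / s := by
      have := hA.ne'
      field_simp; ring
    rw [h1, abs_div, abs_neg, abs_of_pos hs, div_le_iff₀ hs]
    have h2 : |(φ n - t n) / (1 + a n * φ n)| ≤ B := by
      rw [norm_one, mul_one, Real.norm_eq_abs] at hBn
      exact hBn
    have h3 := le_abs_self B
    nlinarith [abs_nonneg B]
  have hMb : |((t n - φ n) / (s * (1 + a n * φ n)) + a n * s) / (1 - (a n * s) ^ 2)| ≤ M := by
    rw [abs_div, abs_of_pos (by linarith : (0 : ℝ) < 1 - (a n * s) ^ 2), div_le_iff₀ (by linarith)]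
    have h1 := abs_add_le ((t n - φ n) / (s * (1 + a n * φ n))) (a n * s)
    have h2 : M * (1 / 2) ≤ M * (1 - (a n * s) ^ 2) := by gcongr
    have := abs_nonneg B
    rw [hM] at h2 ⊢
    linarith
  have hmain := aux_main (a n) s (φ n) (t n) M hs hA hMb hα
  rw [Real.norm_eq_abs, Real.norm_eq_abs]
  refine hmain.trans ?_
  have hp0 : 0 ≤ (n : ℝ) ^ (-(1 : ℝ) / 2) := by positivity
  have hpe : (n : ℝ) ^ (-(3 : ℝ) / 2) = ((n : ℝ) ^ (-(1 : ℝ) / 2)) ^ 3 := by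
    rw [← Real.rpow_natCast, ← Real.rpow_mul (by positivity)]
    norm_num
  have haK : |a n| ≤ |K| * (n : ℝ) ^ (-(1 : ℝ) / 2) := by
    rw [Real.norm_eq_abs, Real.norm_eq_abs, abs_of_nonneg hp0] at hKn
    refine hKn.trans ?_
    gcongr
    exact le_abs_self K
  rw [hpe, abs_of_nonneg (pow_nonneg hp0 3), mul_assoc _ ((2 * |K|) ^ 3), ← mul_pow]
  gcongr
  linarith
end

section
/- Let a ≠ 0, z ∈ ℝ with az ≠ 1, and let c = 1/a − ((1−az)/(2a³))·[(1 + 4a²/(1−az)²)^{1/2} − 1]. Fix φ̂ ∈ ℝ with 1 + aφ̂ > 0 and set φ̂^c = φ̂ − c(1 + aφ̂); assume 1 + aφ̂^c > 0. Then the function ℓ(φ) = −½[(φ̂ − φ)/(1 + aφ) + z]² − log(1 + aφ), defined on {φ : 1 + aφ > 0}, has vanishing derivative at φ = φ̂^c; equivalently, φ̂^c is a stationary point of the log-likelihood of Efron's normal transformation family. -/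
/-- In Efron's normal transformation family, the log-likelihood
`ℓ(φ) = −½[(φ̂ − φ)/(1 + aφ) + z]² − log(1 + aφ)` has vanishing derivative at
`φ̂^c = φ̂ − c(1 + aφ̂)` with `c = c(a,z)`. -/
theorem stmt_6 (a z : ℝ) (ha : a ≠ 0) (haz : a * z ≠ 1)
    (φhat : ℝ) (hφhat : 1 + a * φhat > 0)
    (hφc : 1 + a * (φhat - efronC a z * (1 + a * φhat)) > 0) :
    HasDerivAt (fun φ : ℝ => -(1 / 2) * ((φhat - φ) / (1 + a * φ) + z) ^ 2
        - Real.log (1 + a * φ))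
      0 (φhat - efronC a z * (1 + a * φhat)) := by
  have hk : 1 - a * z ≠ 0 := fun h => haz (by linarith)
  have hquad : a ^ 2 * (1 - a * efronC a z) ^ 2
      + (1 - a * z) * (1 - a * efronC a z) - 1 = 0 := by
    unfold efronC
    have hS : Real.sqrt (1 + 4 * a ^ 2 / (1 - a * z) ^ 2) ^ 2
        = 1 + 4 * a ^ 2 / (1 - a * z) ^ 2 := Real.sq_sqrt (by positivity)
    generalize Real.sqrt (1 + 4 * a ^ 2 / (1 - a * z) ^ 2) = S at hS ⊢
    generalize 1 - a * z = k at hS hk ⊢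
    have h1 : k ^ 2 * (S ^ 2 - 1) = 4 * a ^ 2 := by
      rw [hS]; field_simp; ring
    have h2 : 1 - a * (1 / a - k / (2 * a ^ 3) * (S - 1)) = k * (S - 1) / (2 * a ^ 2) := by
      field_simp; ring
    rw [h2]
    field_simp
    linear_combination h1
  generalize efronC a z = c at hquad hφc ⊢
  have hs : 1 + a * (φhat - c * (1 + a * φhat)) = (1 + a * φhat) * (1 - a * c) := by ring
  generalize hx : φhat - c * (1 + a * φhat) = x at hs hφc ⊢
  have hne : 1 + a * x ≠ 0 := hφc.ne'
  have hd : HasDerivAt (fun φ : ℝ => 1 + a * φ) a x := by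
    simpa using ((hasDerivAt_id x).const_mul a).const_add 1
  have hn : HasDerivAt (fun φ : ℝ => φhat - φ) (-1) x := by
    simpa using (hasDerivAt_id x).const_sub φhat
  have h := ((((hn.div hd hne).add_const z).pow 2).const_mul (-(1 / 2) : ℝ)).sub (hd.log hne)
  refine h.congr_deriv ?_
  have hr : 1 - a * c ≠ 0 := by
    intro h0; rw [hs, h0] at hne; simp at hne
  have hT : 1 + a * φhat ≠ 0 := hφhat.ne'
  have hnum : φhat - x = c * (1 + a * φhat) := by rw [← hx]; ring
  have hW : (φhat - x) / (1 + a * x) + z = a * (1 - a * c) := by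
    rw [hnum, hs, ← eq_sub_iff_add_eq, div_eq_iff (mul_ne_zero hT hr)]
    apply mul_left_cancel₀ ha
    linear_combination -(1 + a * φhat) * hquad
  have hD : (-1 * (1 + a * x) - (φhat - x) * a) = -(1 + a * φhat) := by ring
  simp only [Pi.div_apply]
  rw [hW, hD, hs]
  field_simp
  ring
end

section
/- Define c(a,z) = 1/a − ((1−az)/(2a³))·[(1 + 4a²/(1−az)²)^{1/2} − 1] for a ≠ 0 and az ≠ 1. Let (a_n) and (z_n) be real sequences with a_n ≠ 0, a_n = O(n^{-1/2}) and z_n = a_n(1 + O(n^{-1})) as n → ∞. Then c(a_n, z_n) = a_n − z_n + O(n^{-3/2}), and consequently c(a_n, z_n) = O(n^{-3/2}), as n → ∞. -/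
theorem efronC_aux (a z : ℝ) (ha : a ≠ 0) (ha1 : |a| ≤ 1 / 4) (hz : |z| ≤ 2 * |a|) :
    |efronC a z - (a - z)| ≤ 100 * |a| ^ 3 := by
  have hapos : 0 < |a| := abs_pos.mpr ha
  have ha2 : 0 < a ^ 2 := by positivity
  have hsq : |a| ^ 2 = a ^ 2 := sq_abs a
  have ha16 : a ^ 2 ≤ 1 / 16 := by rw [← hsq]; nlinarith
  have haz : |a * z| ≤ 2 * a ^ 2 := by
    rw [abs_mul, ← hsq]; nlinarith
  have hz2 : z ^ 2 ≤ 4 * a ^ 2 := by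
    rw [← hsq, ← sq_abs z]; nlinarith [abs_nonneg z]
  obtain ⟨u, hu⟩ : ∃ u, u = 1 - a * z := ⟨_, rfl⟩
  have hu1 : |u - 1| ≤ 2 * a ^ 2 := by
    rw [hu, show 1 - a * z - 1 = -(a * z) by ring, abs_neg]; exact haz
  obtain ⟨hl, hr⟩ := abs_le.mp hu1
  have hul : 7 / 8 ≤ u := by linarith
  have hur : u ≤ 9 / 8 := by linarith
  have hu0 : 0 < u := by linarith
  obtain ⟨s, hs⟩ : ∃ s, s = Real.sqrt (1 + 4 * a ^ 2 / u ^ 2) := ⟨_, rfl⟩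
  have ht : 0 ≤ 4 * a ^ 2 / u ^ 2 := by positivity
  have hs1 : 1 ≤ s := by
    rw [hs]; exact Real.one_le_sqrt.mpr (by linarith)
  have hss : s ^ 2 = 1 + 4 * a ^ 2 / u ^ 2 := by
    rw [hs]; exact Real.sq_sqrt (by linarith)
  obtain ⟨p, hp⟩ : ∃ p, p = (s - 1) / a ^ 2 := ⟨_, rfl⟩
  have hp0 : 0 ≤ p := by rw [hp]; exact div_nonneg (by linarith) ha2.le
  have hsp : s = 1 + a ^ 2 * p := by rw [hp]; field_simp; ring
  obtain ⟨v, hv⟩ : ∃ v, v = 1 / u := ⟨_, rfl⟩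
  have huv : u * v = 1 := by rw [hv]; field_simp
  have hv0 : 0 < v := by rw [hv]; positivity
  have hv8 : v ≤ 8 / 7 := by nlinarith
  have hpe : p = 2 * v ^ 2 - a ^ 2 * p ^ 2 / 2 := by
    have h1 : a ^ 2 * (2 * p + a ^ 2 * p ^ 2) = a ^ 2 * (4 * v ^ 2) := by
      have : 4 * a ^ 2 / u ^ 2 = a ^ 2 * (4 * v ^ 2) := by rw [hv]; field_simp
      rw [this, hsp] at hss
      linarith
    have := mul_left_cancel₀ ha2.ne' h1
    linarith
  have hv2 : v ^ 2 ≤ 64 / 49 := by nlinarith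
  have hp3 : p ≤ 3 := by nlinarith [mul_nonneg ha2.le (sq_nonneg p)]
  have hp9 : p ^ 2 ≤ 9 := by
    have := mul_nonneg (sub_nonneg.mpr hp3) (by linarith : 0 ≤ 3 + p)
    linarith
  have hc : efronC a z - (a - z) = a * ((u * p ^ 2 / 4 - 1) - z ^ 2 * v) := by
    have h1 : efronC a z = 1 / a - u * p / (2 * a) := by
      unfold efronC
      rw [← hu, ← hs, hsp]; field_simp; ring
    have h2 : a * efronC a z = 1 - u * p / 2 := by rw [h1]; field_simp
    apply mul_left_cancel₀ ha
    have h3 : a * z = 1 - u := by linarith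
    have h4 : u * p = 2 * v - u * a ^ 2 * p ^ 2 / 2 := by
      have : u * p = 2 * v * (u * v) - u * a ^ 2 * p ^ 2 / 2 := by
        nth_rewrite 1 [hpe]; ring
      rw [this, huv]; ring
    have h5 : a * (a * (u * p ^ 2 / 4 - 1 - z ^ 2 * v))
      = u * a ^ 2 * p ^ 2 / 4 - a ^ 2 - (a * z) ^ 2 * v := by ring
    rw [h5, mul_sub, mul_sub, h2, h3]
    linear_combination (-1 / 2) * h4 + (u - 2) * huv
  have hp2 : |p - 2| ≤ 20 * a ^ 2 := by
    have hv1 : |v - 1| ≤ 3 * a ^ 2 := by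
      have : v - 1 = - (v * (u - 1)) := by linear_combination huv
      rw [this, abs_neg, abs_mul, abs_of_pos hv0]
      nlinarith [abs_nonneg (u - 1)]
    obtain ⟨h1, h2⟩ := abs_le.mp hv1
    have hvv : |(v - 1) * (v + 1)| ≤ 3 * a ^ 2 * (15 / 7) := by
      rw [abs_mul, abs_of_pos (by linarith : 0 < v + 1)]
      gcongr
      linarith
    obtain ⟨h3, h4⟩ := abs_le.mp hvv
    have h5 : (v - 1) * (v + 1) = v ^ 2 - 1 := by ring
    rw [h5] at h3 h4
    have := mul_le_mul_of_nonneg_left hp9 ha2.le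
    have := mul_nonneg ha2.le (sq_nonneg p)
    rw [abs_le]; constructor <;> linarith
  have key : |(u * p ^ 2 / 4 - 1) - z ^ 2 * v| ≤ 100 * a ^ 2 := by
    have e : (u * p ^ 2 / 4 - 1) - z ^ 2 * v
      = (u - 1) * (p ^ 2 / 4) + (p - 2) * ((p + 2) / 4) - z ^ 2 * v := by ring
    have b1 : |(u - 1) * (p ^ 2 / 4)| ≤ 2 * a ^ 2 * (9 / 4) := by
      rw [abs_mul, abs_of_nonneg (by positivity : 0 ≤ p ^ 2 / 4)]
      gcongr
    have b2 : |(p - 2) * ((p + 2) / 4)| ≤ 20 * a ^ 2 * (5 / 4) := by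
      rw [abs_mul, abs_of_nonneg (by positivity : 0 ≤ (p + 2) / 4)]
      gcongr
      linarith
    have b3 : z ^ 2 * v ≤ 4 * a ^ 2 * (8 / 7) := by gcongr
    have b4 : 0 ≤ z ^ 2 * v := by positivity
    rw [e]
    rw [abs_le] at *
    constructor <;> linarith [b1.1, b1.2, b2.1, b2.2]
  rw [hc, abs_mul]
  calc |a| * _ ≤ |a| * (100 * a ^ 2) := by gcongr
    _ = 100 * |a| ^ 3 := by rw [← hsq]; ring

/-- If `aₙ ≠ 0`, `aₙ = O(n^{-1/2})` and `zₙ = aₙ(1 + O(n⁻¹))`, then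
`c(aₙ,zₙ) = aₙ − zₙ + O(n^{-3/2})`, and consequently `c(aₙ,zₙ) = O(n^{-3/2})`. -/
theorem stmt_8 (a z : ℕ → ℝ) (ha : ∀ n, a n ≠ 0) (haz : ∀ n, a n * z n ≠ 1)
    (haO : (fun n : ℕ => a n) =O[Filter.atTop] fun n : ℕ => (n : ℝ) ^ (-(1 : ℝ) / 2))
    (hz : ∃ e : ℕ → ℝ,
      ((fun n : ℕ => e n) =O[Filter.atTop] fun n : ℕ => ((n : ℝ))⁻¹) ∧
      ∀ n, z n = a n * (1 + e n)) :
    ((fun n : ℕ => efronC (a n) (z n) - (a n - z n)) =O[Filter.atTop]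
        fun n : ℕ => (n : ℝ) ^ (-(3 : ℝ) / 2)) ∧
    ((fun n : ℕ => efronC (a n) (z n)) =O[Filter.atTop]
        fun n : ℕ => (n : ℝ) ^ (-(3 : ℝ) / 2)) := by
  obtain ⟨e, he, hze⟩ := hz
  have hinv : Filter.Tendsto (fun n : ℕ => ((n : ℝ))⁻¹) Filter.atTop (nhds 0) :=
    tendsto_inv_atTop_nhds_zero_nat
  have he0 : Filter.Tendsto e Filter.atTop (nhds 0) := he.trans_tendsto hinv
  have hhalf : Filter.Tendsto (fun n : ℕ => (n : ℝ) ^ (-(1 : ℝ) / 2)) Filter.atTop (nhds 0) := by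
    have := (tendsto_rpow_neg_atTop (y := 1 / 2) (by norm_num)).comp
      (tendsto_natCast_atTop_atTop (R := ℝ))
    refine this.congr fun n => ?_
    simp only [Function.comp]
    congr 1; norm_num
  have ha0 : Filter.Tendsto a Filter.atTop (nhds 0) := haO.trans_tendsto hhalf
  have hA : ∀ᶠ n in Filter.atTop, |a n| ≤ 1 / 4 := by
    filter_upwards [ha0.eventually (Metric.ball_mem_nhds 0 (by norm_num : (0:ℝ) < 1 / 4))] with n hn
    simpa using (le_of_lt (by simpa using hn : |a n| < 4⁻¹))
  have hE : ∀ᶠ n in Filter.atTop, |e n| ≤ 1 := by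
    filter_upwards [he0.eventually (Metric.ball_mem_nhds 0 (by norm_num : (0:ℝ) < 1))] with n hn
    exact (le_of_lt (by simpa using hn : |e n| < 1))
  have h3 : (fun n : ℕ => a n ^ 3) =O[Filter.atTop] fun n : ℕ => (n : ℝ) ^ (-(3 : ℝ) / 2) := by
    refine (haO.pow 3).congr_right fun n => ?_
    rw [← Real.rpow_natCast, ← Real.rpow_mul (Nat.cast_nonneg n)]
    norm_num
  have hd : (fun n : ℕ => a n - z n) =O[Filter.atTop] fun n : ℕ => (n : ℝ) ^ (-(3 : ℝ) / 2) := by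
    have h := (haO.mul he).neg_left
    refine h.congr' (Filter.Eventually.of_forall fun n => ?_) ?_
    · simp only [hze n]; ring
    · filter_upwards [Filter.eventually_gt_atTop 0] with n hn
      have hn' : (0 : ℝ) < n := by exact_mod_cast hn
      rw [← Real.rpow_neg_one, ← Real.rpow_add hn']
      norm_num
  have h1 : (fun n : ℕ => efronC (a n) (z n) - (a n - z n)) =O[Filter.atTop]
        fun n : ℕ => (n : ℝ) ^ (-(3 : ℝ) / 2) := by
    refine Asymptotics.IsBigO.trans (Asymptotics.IsBigO.of_bound 100 ?_) h3
    filter_upwards [hA, hE] with n hn1 hn2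
    rw [Real.norm_eq_abs, Real.norm_eq_abs, abs_pow]
    refine efronC_aux _ _ (ha n) hn1 ?_
    rw [hze n, abs_mul, mul_comm]
    gcongr
    rw [abs_le] at *
    constructor <;> linarith [hn2.1, hn2.2]
  exact ⟨h1, by simpa using h1.add hd⟩
end

section
/- Let a ≠ 0, z, c be real numbers with ac ≠ 1, set s = 1 − ac and z^c = z + c/s. Let ℓ(φ;t) = −½[(t − φ)/(1 + aφ) + z]² − log(1 + aφ) for 1 + aφ > 0, and for observed t with 1 + at > 0 set t^c = t − c(1 + at), assuming 1 + a t^c > 0. Then for every φ with 1 + aφ > 0: (i) ℓ(φ;t) = −½[(t^c − φ)/(s(1 + aφ)) + z^c]² − log(1 + aφ); and (ii) 2[ℓ(t^c;t) − ℓ(φ;t)] = −(z^c)² + ((t^c − φ)/(s(1 + aφ)) + z^c)² − 2 log((1 + a t^c)/(1 + aφ)). -/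
/-- In Efron's normal transformation family with observed `t`, setting
`s = 1 − ac`, `z^c = z + c/s` and `t^c = t − c(1 + at)`, the log-likelihood
`ℓ(φ;t) = −½[(t − φ)/(1 + aφ) + z]² − log(1 + aφ)` satisfies, for every `φ` with
`1 + aφ > 0`: (i) `ℓ(φ;t) = −½[(t^c − φ)/(s(1 + aφ)) + z^c]² − log(1 + aφ)`, and
(ii) `2[ℓ(t^c;t) − ℓ(φ;t)] = −(z^c)² + ((t^c − φ)/(s(1 + aφ)) + z^c)²
      − 2 log((1 + at^c)/(1 + aφ))`. -/
theorem stmt_10 (a z c : ℝ) (ha : a ≠ 0) (hac : a * c ≠ 1)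
    (t : ℝ) (ht : 1 + a * t > 0)
    (htc : 1 + a * (t - c * (1 + a * t)) > 0)
    (ℓ : ℝ → ℝ)
    (hℓ : ∀ φ : ℝ, 1 + a * φ > 0 →
      ℓ φ = -(1 / 2) * ((t - φ) / (1 + a * φ) + z) ^ 2 - Real.log (1 + a * φ)) :
    ∀ φ : ℝ, 1 + a * φ > 0 →
      (ℓ φ = -(1 / 2) * (((t - c * (1 + a * t)) - φ) / ((1 - a * c) * (1 + a * φ))
          + (z + c / (1 - a * c))) ^ 2 - Real.log (1 + a * φ)) ∧
      (2 * (ℓ (t - c * (1 + a * t)) - ℓ φ) =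
        -(z + c / (1 - a * c)) ^ 2
        + (((t - c * (1 + a * t)) - φ) / ((1 - a * c) * (1 + a * φ))
            + (z + c / (1 - a * c))) ^ 2
        - 2 * Real.log ((1 + a * (t - c * (1 + a * t))) / (1 + a * φ))) := by
  have hs : (1 - a * c) ≠ 0 := fun h => hac (by linarith)
  have key : ∀ φ : ℝ, 1 + a * φ > 0 →
      (ℓ φ = -(1 / 2) * (((t - c * (1 + a * t)) - φ) / ((1 - a * c) * (1 + a * φ))
          + (z + c / (1 - a * c))) ^ 2 - Real.log (1 + a * φ)) := by
    intro φ hφ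
    have hφ' : 1 + a * φ ≠ 0 := hφ.ne'
    have e : (t - φ) / (1 + a * φ) + z
        = ((t - c * (1 + a * t)) - φ) / ((1 - a * c) * (1 + a * φ))
          + (z + c / (1 - a * c)) := by
      have e2 : (t - φ) / (1 + a * φ)
        = ((t - c * (1 + a * t)) - φ) / ((1 - a * c) * (1 + a * φ))
          + c / (1 - a * c) := by
        rw [div_add_div _ _ (mul_ne_zero hs hφ') hs, div_eq_div_iff hφ'
          (mul_ne_zero (mul_ne_zero hs hφ') hs)]
        ring
      rw [e2]; ring
    rw [hℓ φ hφ, e]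
  intro φ hφ
  refine ⟨key φ hφ, ?_⟩
  rw [key φ hφ, key _ htc, Real.log_div htc.ne' hφ.ne', sub_self, zero_div]
  ring
end

section
/- Let (Ω, P) be a probability space, θ ∈ ℝ, and H : ℝ × Ω → ℝ a jointly measurable function such that for every ω ∈ Ω the map x ↦ H(x,ω) is continuous and strictly increasing with H(x,ω) → 0 as x → −∞ and H(x,ω) → 1 as x → +∞, and such that the random variable ω ↦ H(θ,ω) is uniformly distributed on (0,1). Let θ̃(ω) be the unique solution of H(θ̃(ω),ω) = 1/2. Then P(θ̃ > θ) = 1/2, i.e. the median confidence estimator θ̃ is median-unbiased. -/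
open MeasureTheory

/-- If `H(·,ω)` is, for every `ω`, a continuous strictly increasing
distribution function on the parameter space (tending to `0` at `−∞` and to `1` at
`+∞`), jointly measurable, and `H(θ,·)` is uniform on `(0,1)` under `P`, then the
median confidence estimator `θ̃`, the unique solution of `H(θ̃(ω),ω) = 1/2`, is
median-unbiased: `P(θ̃ > θ) = 1/2`. -/
theorem stmt_11 {Ω : Type*} [MeasurableSpace Ω] (P : Measure Ω) [IsProbabilityMeasure P]
    (θ : ℝ) (H : ℝ → Ω → ℝ)
    (hmeas : Measurable (Function.uncurry H))
    (hcont : ∀ ω : Ω, Continuous fun x => H x ω)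
    (hmono : ∀ ω : Ω, StrictMono fun x => H x ω)
    (hbot : ∀ ω : Ω, Filter.Tendsto (fun x => H x ω) Filter.atBot (nhds 0))
    (htop : ∀ ω : Ω, Filter.Tendsto (fun x => H x ω) Filter.atTop (nhds 1))
    (hunif : P.map (fun ω => H θ ω) = volume.restrict (Set.Ioo (0 : ℝ) 1))
    (θtilde : Ω → ℝ) (hθtilde : ∀ ω : Ω, H (θtilde ω) ω = 1 / 2) :
    P {ω : Ω | θ < θtilde ω} = 1 / 2 := by
  have hm : Measurable (fun ω => H θ ω) := hmeas.comp measurable_prodMk_left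
  have hset : {ω : Ω | θ < θtilde ω} = (fun ω => H θ ω) ⁻¹' Set.Iio (1 / 2 : ℝ) := by
    ext ω
    have h := (hmono ω).lt_iff_lt (a := θ) (b := θtilde ω)
    simp only [hθtilde ω] at h
    exact h.symm
  have hI : Set.Iio (1 / 2 : ℝ) ∩ Set.Ioo 0 1 = Set.Ioo 0 (1 / 2) := by
    ext x
    simp only [Set.mem_inter_iff, Set.mem_Iio, Set.mem_Ioo]
    constructor
    · rintro ⟨h1, h2, h3⟩
      exact ⟨h2, h1⟩
    · rintro ⟨h1, h2⟩
      exact ⟨h2, h1, by linarith⟩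
  rw [hset, ← Measure.map_apply hm measurableSet_Iio, hunif,
    Measure.restrict_apply measurableSet_Iio, hI, Real.volume_Ioo, sub_zero,
    ENNReal.ofReal_div_of_pos two_pos]
  simp
end
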